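/- Let ℓ > 0, set τ := 2πi/ℓ, and let n ≥ 2. Fix points z₁,…,z_{n+1} ∈ ℂ with z_j − z_k ∉ Λ_ℓ for all j ≠ k. Then, on the set of μ ∈ ℝ with θ₃(μ;τ) ≠ 0, the function μ ↦ ∑_{σ∈Cₙ} ∏_{k=1}^n f_μ(z_{σ(k)} − z_k) is differentiable and its derivative equals (πℓ/(2i))·∑_{σ∈C_{n+1}} ∏_{k=1}^{n+1} f_μ(z_{σ(k)} − z_k). -/

import Mathlib

open Complex

noncomputable section

/-- Jacobi theta function `θ₁(w;τ)` with nome `q = exp(iπτ)`. -/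
def theta1 (τ w : ℂ) : ℂ :=
  -Complex.I * ∑' n : ℤ, (-1 : ℂ) ^ n *
    Complex.exp (Real.pi * Complex.I * τ * ((n : ℂ) + 1 / 2) ^ 2) *
    Complex.exp ((2 * (n : ℂ) + 1) * Real.pi * Complex.I * w)

/-- Jacobi theta function `θ₃(w;τ)` with nome `q = exp(iπτ)`. -/
def theta3 (τ w : ℂ) : ℂ :=
  ∑' n : ℤ, Complex.exp (Real.pi * Complex.I * τ * (n : ℂ) ^ 2) *
    Complex.exp (2 * Real.pi * Complex.I * (n : ℂ) * w)

/-- The modulus `τ = 2πi/ℓ`. -/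
def tau (ℓ : ℝ) : ℂ := 2 * Real.pi * Complex.I / (ℓ : ℂ)

/-- The function `g_μ(w) = (2/(πi))·θ₁′(0;τ)·θ₃(w+μ;τ)/(θ₃(μ;τ)·θ₁(w;τ))` with `τ = 2πi/ℓ`. -/
def gmu (ℓ μ : ℝ) (w : ℂ) : ℂ :=
  2 / (Real.pi * Complex.I) * deriv (theta1 (tau ℓ)) 0 * theta3 (tau ℓ) (w + (μ : ℂ)) /
    (theta3 (tau ℓ) (μ : ℂ) * theta1 (tau ℓ) w)

/-- The function `f_μ(z) = ℓ⁻¹ g_μ(z/ℓ)`. -/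
def fmu (ℓ μ : ℝ) (z : ℂ) : ℂ := (ℓ : ℂ)⁻¹ * gmu ℓ μ (z / (ℓ : ℂ))

/-- The lattice `{m ω₁ + n ω₂ : m, n ∈ ℤ}`. -/
def lat (ω₁ ω₂ : ℂ) : Set ℂ := {z : ℂ | ∃ m n : ℤ, z = (m : ℂ) * ω₁ + (n : ℂ) * ω₂}

/-- The Weierstrass `℘`-function for the lattice spanned by `ω₁, ω₂`:
`℘(z) = z⁻² + ∑_{ω ∈ Λ∖{0}} ((z−ω)⁻² − ω⁻²)`. -/
def wp (ω₁ ω₂ : ℂ) (z : ℂ) : ℂ :=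
  1 / z ^ 2 + ∑' p : {p : ℤ × ℤ // p ≠ 0},
    (1 / (z - ((p.1.1 : ℂ) * ω₁ + (p.1.2 : ℂ) * ω₂)) ^ 2
      - 1 / ((p.1.1 : ℂ) * ω₁ + (p.1.2 : ℂ) * ω₂) ^ 2)

/-- The point `z_μ = (1/2 − μ)ℓ + πi`. -/
def zmu (ℓ μ : ℝ) : ℂ := (1 / 2 - (μ : ℂ)) * (ℓ : ℂ) + Real.pi * Complex.I

open scoped Classical in
/-- The cycle sum `∑_{σ ∈ Cₙ} ∏_{k=1}^n f(z_{σ(k)} − z_k)`, where `Cₙ` is the set of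
permutations of `{1,…,n}` consisting of a single `n`-cycle. -/
def cycleSum (n : ℕ) (f : ℂ → ℂ) (z : Fin n → ℂ) : ℂ :=
  ∑ σ ∈ Finset.univ.filter
      (fun σ : Equiv.Perm (Fin n) => σ.IsCycle ∧ σ.support = Finset.univ),
    ∏ k : Fin n, f (z (σ k) - z k)

/-- The open horizontal strip `S = {0 < Im z < π}`. -/
def strip : Set ℂ := {z : ℂ | 0 < z.im ∧ z.im < Real.pi}

/-- The top substrip `S_ε = {π − ε < Im z < π}`. -/
def topStrip (ε : ℝ) : Set ℂ := {z : ℂ | Real.pi - ε < z.im ∧ z.im < Real.pi}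

end

section Comb
open Equiv Equiv.Perm

theorem aux_sameCycle_rel {β γ : Type*} [Finite β] (f : Equiv.Perm β) (g : Equiv.Perm γ)
    (r : β → γ) (h : ∀ x, g.SameCycle (r x) (r (f x))) {x y : β} (hxy : f.SameCycle x y) :
    g.SameCycle (r x) (r y) := by
  obtain ⟨i, -, rfl⟩ := hxy.exists_pow_eq'
  clear hxy
  induction i with
  | zero => simpa using SameCycle.refl _ _
  | succ i ih =>
    rw [pow_succ']
    exact ih.trans (h _)

def IsFull {β : Type*} (f : Equiv.Perm β) : Prop := ∀ x y, f.SameCycle x y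

theorem isFull_iff {β : Type*} [Fintype β] [DecidableEq β] [Nontrivial β] (f : Equiv.Perm β) :
    (f.IsCycle ∧ f.support = Finset.univ) ↔ IsFull f := by
  constructor
  · rintro ⟨h, hs⟩ x y
    have : ∀ x, f x ≠ x := fun x => by
      rw [← Equiv.Perm.mem_support, hs]; exact Finset.mem_univ _
    exact h.sameCycle (this x) (this y)
  · intro h
    have hne : ∀ x, f x ≠ x := by
      intro x hx
      obtain ⟨y, hy⟩ := exists_ne x
      have := h x y
      exact hy (this.eq_of_left hx).symm
    refine ⟨?_, ?_⟩
    · obtain ⟨x⟩ := (inferInstance : Nonempty β)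
      exact ⟨x, hne x, fun y _ => h x y⟩
    · ext x; simp [hne x]

theorem isFull_insert {α : Type*} [Finite α] [DecidableEq α] (σ : Equiv.Perm α) (a : α) :
    IsFull (decomposeOption.symm (some a, σ)) ↔ IsFull σ := by
  set π := decomposeOption.symm (some a, σ) with hπ
  have h0 : π none = some a := by simp [hπ]
  have h1 : ∀ x, σ x = a → π (some x) = none := by
    intro x hx; simp [hπ, hx]
  have h2 : ∀ x, σ x ≠ a → π (some x) = some (σ x) := by
    intro x hx
    simp [hπ]
    rw [Equiv.swap_apply_of_ne_of_ne] <;> simp [hx]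
  constructor
  · intro h x y
    have := aux_sameCycle_rel π σ (fun o => o.getD a) (by
      rintro (_ | x)
      · simp [h0]; exact SameCycle.refl _ _
      · by_cases hx : σ x = a
        · rw [h1 x hx]; simp [← hx]; exact SameCycle.refl _ _
        · rw [h2 x hx]; simp;  exact SameCycle.refl _ _) (h (some x) (some y))
    simpa using this
  · intro h
    have key : ∀ x y, π.SameCycle (some x) (some y) := fun x y =>
      aux_sameCycle_rel σ π some (by
        intro x
        by_cases hx : σ x = a
        · refine ⟨2, ?_⟩
          have : π (π (some x)) = some (σ x) := by rw [h1 x hx, h0, hx]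
          simpa [zpow_ofNat, pow_two] using this
        · refine ⟨1, ?_⟩
          simpa using h2 x hx) (h x y)
    have hn : ∀ x, π.SameCycle none (some x) := fun x =>
      SameCycle.trans ⟨1, by simpa using h0⟩ (key a x)
    rintro (_ | x) (_ | y)
    · exact SameCycle.refl _ _
    · exact hn y
    · exact (hn x).symm
    · exact key x y

theorem prod_insert {α : Type*} [Fintype α] [DecidableEq α] (σ : Equiv.Perm α) (k : α)
    (F : Option α → Option α → ℂ) :
    ∏ o : Option α, F (decomposeOption.symm (some (σ k), σ) o) o =
      (∏ j ∈ Finset.univ.erase k, F (some (σ j)) (some j)) * (F (some (σ k)) none * F none (some k)) := by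
  rw [Fintype.prod_option, ← Finset.mul_prod_erase Finset.univ _ (Finset.mem_univ k)]
  have : ∀ j ∈ Finset.univ.erase k, F (decomposeOption.symm (some (σ k), σ) (some j)) (some j)
      = F (some (σ j)) (some j) := by
    intro j hj
    have hj : j ≠ k := by simpa using hj
    simp
    rw [Equiv.swap_apply_of_ne_of_ne] <;> simp [hj]
  rw [Finset.prod_congr rfl this]
  simp
  ring

theorem full_sum_option {α : Type*} [Fintype α] [Nontrivial α] [DecidableEq α]
    [Fintype (Equiv.Perm (Option α))] [Fintype (Equiv.Perm α)]
    [DecidablePred (IsFull (β := Option α))] [DecidablePred (IsFull (β := α))]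
    (F : Option α → Option α → ℂ) :
    ∑ π : Equiv.Perm (Option α) with IsFull π, ∏ o, F (π o) o =
    ∑ σ : Equiv.Perm α with IsFull σ, ∑ k,
      (∏ j ∈ Finset.univ.erase k, F (some (σ j)) (some j)) *
        (F (some (σ k)) none * F none (some k)) := by
  rw [Finset.sum_filter, ← Equiv.sum_comp decomposeOption.symm, Fintype.sum_prod_type,
    Fintype.sum_option]
  have h0 : ∀ σ : Equiv.Perm α, ¬ IsFull (decomposeOption.symm (none, σ)) := by
    intro σ h
    obtain ⟨x⟩ := (inferInstance : Nonempty α)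
    have := h none (some x)
    have h2 := this.eq_of_left (by simp [Function.IsFixedPt])
    simp at h2
  simp only [h0, if_false, Finset.sum_const_zero, zero_add, isFull_insert]
  rw [Finset.sum_comm, Finset.sum_filter]
  refine Finset.sum_congr rfl fun σ _ => ?_
  split_ifs with h
  · rw [← Equiv.sum_comp σ]
    refine Finset.sum_congr rfl fun k _ => ?_
    exact prod_insert σ k F
  · simp

open scoped Classical in
noncomputable def fullSet (n : ℕ) : Finset (Equiv.Perm (Fin n)) :=
  Finset.univ.filter (fun σ => IsFull σ)

theorem cycleSum_eq (n : ℕ) (hn : 2 ≤ n) (f : ℂ → ℂ) (z : Fin n → ℂ) :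
    cycleSum n f z = ∑ σ ∈ fullSet n,
      ∏ k, f (z (σ k) - z k) := by
  classical
  have : Nontrivial (Fin n) := Fin.nontrivial_iff_two_le.2 hn
  unfold cycleSum fullSet
  refine Finset.sum_congr ?_ fun _ _ => rfl
  ext σ
  simp only [Finset.mem_filter, Finset.mem_univ, true_and]
  convert isFull_iff σ

theorem isFull_conj {α β : Type*} (e : α ≃ β) (σ : Equiv.Perm α) :
    IsFull (e.permCongr σ) ↔ IsFull σ := by
  have : ∀ x y, (e.permCongr σ).SameCycle (e x) (e y) ↔ σ.SameCycle x y := by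
    intro x y
    have h : ∀ i : ℤ, (e.permCongr σ) ^ i = e.permCongr (σ ^ i) := fun i =>
      (map_zpow e.permCongrHom σ i).symm
    simp only [SameCycle, h]
    simp
  constructor
  · intro h x y; exact (this x y).1 (h _ _)
  · intro h x y
    simpa using (this (e.symm x) (e.symm y)).2 (h _ _)

theorem full_sum_equiv {α β : Type*} [Fintype α] [Fintype β] [Fintype (Equiv.Perm α)]
    [Fintype (Equiv.Perm β)]
    [DecidablePred (IsFull (β := α))] [DecidablePred (IsFull (β := β))] (e : α ≃ β) (F : α → α → ℂ) :
    ∑ σ : Equiv.Perm α with IsFull σ, ∏ k, F (σ k) k =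
      ∑ π : Equiv.Perm β with IsFull π, ∏ o, F (e.symm (π o)) (e.symm o) := by
  rw [Finset.sum_filter, Finset.sum_filter]
  refine Fintype.sum_equiv e.permCongr _ _ fun σ => ?_
  simp only [isFull_conj]
  split_ifs
  swap
  · rfl
  rw [← Equiv.prod_comp e]
  simp

theorem cycleSum_succ (n : ℕ) (hn : 2 ≤ n) (f : ℂ → ℂ) (z : Fin (n + 1) → ℂ) :
    cycleSum (n + 1) f z =
      ∑ σ ∈ fullSet n, ∑ k,
        (∏ j ∈ Finset.univ.erase k, f (z (σ j).castSucc - z j.castSucc)) *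
          (f (z (σ k).castSucc - z (Fin.last n)) * f (z (Fin.last n) - z k.castSucc)) := by
  classical
  have : Nontrivial (Fin n) := Fin.nontrivial_iff_two_le.2 hn
  rw [cycleSum_eq _ (by omega)]
  unfold fullSet
  rw [full_sum_equiv (finSuccEquivLast (n := n)) (fun a b => f (z a - z b)),
    full_sum_option (α := Fin n)
      (fun a b => f (z (finSuccEquivLast.symm a) - z (finSuccEquivLast.symm b)))]
  simp only [finSuccEquivLast_symm_some, finSuccEquivLast_symm_none]
end Comb

section Theta

theorem hasSum_congr_aux {ι : Type*} {f g : ι → ℂ} {a : ℂ} (h : ∀ i, f i = g i) :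
    HasSum f a ↔ HasSum g a := by
  rw [funext h]

theorem theta3_eq (τ w : ℂ) : theta3 τ w = jacobiTheta₂ w τ := by
  unfold theta3 jacobiTheta₂
  refine tsum_congr fun n => ?_
  rw [jacobiTheta₂_term, ← Complex.exp_add]
  congr 1; ring

theorem negone_zpow (n : ℤ) : (-1 : ℂ) ^ n = Complex.exp (Real.pi * Complex.I * n) := by
  rw [mul_comm, Complex.exp_int_mul, Complex.exp_pi_mul_I]

noncomputable def t1term (τ : ℂ) (n : ℤ) (w : ℂ) : ℂ :=
  -Complex.I * Complex.exp (Real.pi * Complex.I * n + Real.pi * Complex.I * τ * ((n : ℂ) + 1 / 2) ^ 2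
    + (2 * (n : ℂ) + 1) * Real.pi * Complex.I * w)

theorem t1term_eq (τ w : ℂ) (n : ℤ) : t1term τ n w =
    -Complex.I * Complex.exp (Real.pi * Complex.I * τ / 4 + Real.pi * Complex.I * w) *
      jacobiTheta₂_term n (w + 1 / 2 + τ / 2) τ := by
  rw [t1term, jacobiTheta₂_term, mul_assoc (-Complex.I), ← Complex.exp_add]
  congr 2; ring

theorem theta1_eq (τ w : ℂ) : theta1 τ w =
    -Complex.I * Complex.exp (Real.pi * Complex.I * τ / 4 + Real.pi * Complex.I * w) *
      jacobiTheta₂ (w + 1 / 2 + τ / 2) τ := by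
  rw [theta1, jacobiTheta₂, ← tsum_mul_left, ← tsum_mul_left]
  refine tsum_congr fun n => ?_
  rw [← t1term_eq, t1term, negone_zpow, Complex.exp_add, Complex.exp_add]

theorem hasSum_theta1 {τ : ℂ} (hτ : 0 < τ.im) (w : ℂ) :
    HasSum (fun n => t1term τ n w) (theta1 τ w) := by
  simp only [t1term_eq, theta1_eq]
  exact (hasSum_jacobiTheta₂_term _ hτ).mul_left _

noncomputable def tA (τ x : ℂ) : ℂ := jacobiTheta₂ (2 * x) (2 * τ)
noncomputable def tB (τ x : ℂ) : ℂ := Complex.exp (Real.pi * Complex.I * τ / 2 + 2 * Real.pi * Complex.I * x) *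
  jacobiTheta₂ (2 * x + τ) (2 * τ)

noncomputable def aterm (τ x : ℂ) (N : ℂ) : ℂ :=
  Complex.exp (Real.pi * Complex.I * τ * N ^ 2 / 2 + 2 * Real.pi * Complex.I * N * x)

theorem im2 {τ : ℂ} (hτ : 0 < τ.im) : 0 < (2 * τ).im := by simpa using hτ

theorem hasSum_tA {τ : ℂ} (hτ : 0 < τ.im) (x : ℂ) :
    HasSum (fun k : ℤ => aterm τ x (2 * k)) (tA τ x) := by
  refine (hasSum_congr_aux fun k => ?_).2 (hasSum_jacobiTheta₂_term (2 * x) (im2 hτ))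
  rw [aterm, jacobiTheta₂_term]; congr 1; ring

theorem hasSum_tB {τ : ℂ} (hτ : 0 < τ.im) (x : ℂ) :
    HasSum (fun k : ℤ => aterm τ x (2 * k + 1)) (tB τ x) := by
  refine (hasSum_congr_aux fun k => ?_).2 ((hasSum_jacobiTheta₂_term (2 * x + τ) (im2 hτ)).mul_left
    (Complex.exp (Real.pi * Complex.I * τ / 2 + 2 * Real.pi * Complex.I * x)))
  rw [aterm, jacobiTheta₂_term, ← Complex.exp_add]; congr 1; ring

theorem hasSum_mul' {f g : ℤ → ℂ} {a b : ℂ} (hf : HasSum f a) (hg : HasSum g b) :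
    HasSum (fun p : ℤ × ℤ => f p.1 * g p.2) (a * b) :=
  hf.mul hg (summable_mul_of_summable_norm hf.summable.norm hg.summable.norm)

def emb1 (p : ℤ × ℤ) : ℤ × ℤ := (p.1 + p.2, p.1 - p.2 - 1)
def emb2 (p : ℤ × ℤ) : ℤ × ℤ := (p.1 + p.2, p.1 - p.2)

theorem emb1_inj : Function.Injective emb1 := by
  rintro ⟨a, b⟩ ⟨c, d⟩ h
  simp only [emb1, Prod.mk.injEq] at h ⊢
  omega

theorem emb2_inj : Function.Injective emb2 := by
  rintro ⟨a, b⟩ ⟨c, d⟩ h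
  simp only [emb2, Prod.mk.injEq] at h ⊢
  omega

theorem emb_compl : IsCompl (Set.range emb1) (Set.range emb2) := by
  rw [isCompl_iff, disjoint_iff, codisjoint_iff]
  constructor
  · ext ⟨a, b⟩
    simp only [Set.inf_eq_inter, Set.mem_inter_iff, Set.mem_range, Prod.exists, emb1, emb2,
      Prod.mk.injEq, Set.bot_eq_empty, Set.mem_empty_iff_false, iff_false]
    rintro ⟨⟨c, d, h⟩, e, f, h'⟩
    omega
  · ext ⟨a, b⟩
    simp only [Set.sup_eq_union, Set.mem_union, Set.mem_range, Prod.exists, emb1, emb2,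
      Prod.mk.injEq, Set.top_eq_univ, Set.mem_univ, iff_true]
    rcases Int.even_or_odd' (a + b) with ⟨k, hk | hk⟩
    · exact Or.inr ⟨k, a - k, by omega, by omega⟩
    · exact Or.inl ⟨k + 1, a - k - 1, by omega, by omega⟩

theorem bilin {τ : ℂ} (hτ : 0 < τ.im) (x y : ℂ) :
    theta1 τ (x + y) * theta1 τ (x - y) = tA τ x * tB τ y - tB τ x * tA τ y := by
  have H := hasSum_mul' (hasSum_theta1 hτ (x + y)) (hasSum_theta1 hτ (x - y))
  have H1 := hasSum_mul' (hasSum_tA hτ x) (hasSum_tB hτ y)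
  have H2 := (hasSum_mul' (hasSum_tB hτ x) (hasSum_tA hτ y)).neg
  have e1 : HasSum ((fun p : ℤ × ℤ => t1term τ p.1 (x + y) * t1term τ p.2 (x - y)) ∘ emb1)
      (tA τ x * tB τ y) := by
    refine (hasSum_congr_aux fun p => ?_).2 H1
    obtain ⟨k, l⟩ := p
    simp only [Function.comp, emb1, t1term, aterm]
    rw [mul_mul_mul_comm, ← Complex.exp_add, ← Complex.exp_add]
    have : -Complex.I * -Complex.I = Complex.exp (Real.pi * Complex.I) := by
      rw [Complex.exp_pi_mul_I]; simp
    rw [this, ← Complex.exp_add, Complex.exp_eq_exp_iff_exists_int]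
    refine ⟨k, ?_⟩
    push_cast; ring
  have e2 : HasSum ((fun p : ℤ × ℤ => t1term τ p.1 (x + y) * t1term τ p.2 (x - y)) ∘ emb2)
      (-(tB τ x * tA τ y)) := by
    refine (hasSum_congr_aux fun p => ?_).2 H2
    obtain ⟨k, l⟩ := p
    simp only [Function.comp, emb2, t1term, aterm]
    rw [mul_mul_mul_comm, ← Complex.exp_add, ← Complex.exp_add]
    have : -Complex.I * -Complex.I = -1 := by simp
    rw [this, neg_one_mul, neg_inj, Complex.exp_eq_exp_iff_exists_int]
    refine ⟨k, ?_⟩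
    push_cast; ring
  have e1' := emb1_inj.hasSum_range_iff.2 e1
  have e2' := emb2_inj.hasSum_range_iff.2 e2
  rw [H.unique (e1'.add_isCompl emb_compl e2')]
  ring

theorem theta1_diff {τ : ℂ} (hτ : 0 < τ.im) : Differentiable ℂ (theta1 τ) := by
  have : theta1 τ = fun w => -Complex.I * Complex.exp (Real.pi * Complex.I * τ / 4 + Real.pi * Complex.I * w) *
      jacobiTheta₂ (w + 1 / 2 + τ / 2) τ := funext (theta1_eq τ)
  rw [this]
  have hJ : Differentiable ℂ (jacobiTheta₂ · τ) := fun z => differentiableAt_jacobiTheta₂_fst z hτ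
  have : Differentiable ℂ (fun w => jacobiTheta₂ (w + 1 / 2 + τ / 2) τ) :=
    hJ.comp (g := (jacobiTheta₂ · τ)) (f := fun w => w + 1 / 2 + τ / 2) (by fun_prop)
  fun_prop

theorem theta3_diff {τ : ℂ} (hτ : 0 < τ.im) : Differentiable ℂ (theta3 τ) := by
  have : theta3 τ = (jacobiTheta₂ · τ) := funext (theta3_eq τ)
  rw [this]
  exact fun z => differentiableAt_jacobiTheta₂_fst z hτ

theorem tA_diff {τ : ℂ} (hτ : 0 < τ.im) : Differentiable ℂ (tA τ) := by
  have hJ : Differentiable ℂ (jacobiTheta₂ · (2 * τ)) :=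
    fun z => differentiableAt_jacobiTheta₂_fst z (im2 hτ)
  exact hJ.comp (g := (jacobiTheta₂ · (2 * τ))) (f := fun w => 2 * w) (by fun_prop)

theorem tB_diff {τ : ℂ} (hτ : 0 < τ.im) : Differentiable ℂ (tB τ) := by
  have hJ : Differentiable ℂ (jacobiTheta₂ · (2 * τ)) :=
    fun z => differentiableAt_jacobiTheta₂_fst z (im2 hτ)
  have := hJ.comp (g := (jacobiTheta₂ · (2 * τ))) (f := fun w => 2 * w + τ) (by fun_prop)
  unfold tB
  exact Differentiable.mul (by fun_prop) this

theorem theta3_shift (τ w : ℂ) :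
    theta3 τ w = Complex.exp (Real.pi * Complex.I * τ / 4 + Real.pi * Complex.I * w) *
      theta1 τ (w + (1 + τ) / 2) := by
  rw [theta1_eq, theta3_eq,
    show w + (1 + τ) / 2 + 1 / 2 + τ / 2 = (w + τ) + 1 by ring, jacobiTheta₂_add_left,
    jacobiTheta₂_add_left']
  have : -Complex.I = Complex.exp (-(Real.pi / 2 * Complex.I)) := by
    rw [Complex.exp_neg, Complex.exp_pi_div_two_mul_I]; simp
  rw [this, ← mul_assoc, ← mul_assoc, ← Complex.exp_add, ← Complex.exp_add, ← Complex.exp_add]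
  ring_nf
  simp

theorem theta1_neg (τ w : ℂ) : theta1 τ (-w) = - theta1 τ w := by
  rw [theta1_eq, theta1_eq, show -w + 1 / 2 + τ / 2 = -((w + 1/2 - τ/2) - 1) by ring,
    jacobiTheta₂_neg_left, ← jacobiTheta₂_add_left, sub_add_cancel,
    show w + 1 / 2 + τ / 2 = (w + 1 / 2 - τ / 2) + τ by ring, jacobiTheta₂_add_left',
    ← mul_assoc, ← neg_mul]
  congr 1
  have key : Complex.exp (Real.pi * Complex.I * τ / 4 + Real.pi * Complex.I * w) *
      Complex.exp (-Real.pi * Complex.I * (τ + 2 * (w + 1 / 2 - τ / 2))) =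
      -Complex.exp (Real.pi * Complex.I * τ / 4 + Real.pi * Complex.I * -w) := by
    rw [← neg_one_mul (Complex.exp _), ← Complex.exp_pi_mul_I, ← Complex.exp_add,
      ← Complex.exp_add, Complex.exp_eq_exp_iff_exists_int]
    refine ⟨-1, ?_⟩
    push_cast; ring
  linear_combination -Complex.I * key

theorem theta1_zero (τ : ℂ) : theta1 τ 0 = 0 := by
  have := theta1_neg τ 0
  rw [neg_zero] at this
  linear_combination this / 2

theorem three_term {τ : ℂ} (hτ : 0 < τ.im) (u v a s : ℂ) :
    theta1 τ (u + v + a + s) * theta1 τ a * theta1 τ u * theta1 τ (s - v)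
     - theta1 τ (a + u + s) * theta1 τ (a + v) * theta1 τ (u + v) * theta1 τ s
     + theta1 τ (u + v + a) * theta1 τ (a + s) * theta1 τ (u + s) * theta1 τ v = 0 := by
  have H := bilin hτ
  have h1 := H (a + (u + v + s) / 2) ((u + v + s) / 2)
  have h2 := H ((u + s - v) / 2) ((u + v - s) / 2)
  have h3 := H (a + (u + v + s) / 2) ((u + s - v) / 2)
  have h4 := H ((u + v + s) / 2) ((u + v - s) / 2)
  have h5 := H (a + (u + v + s) / 2) ((u + v - s) / 2)
  have h6 := H ((u + v + s) / 2) ((u + s - v) / 2)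
  ring_nf at h1 h2 h3 h4 h5 h6 ⊢
  grind

theorem fay1 {τ : ℂ} (hτ : 0 < τ.im) (u v a : ℂ) :
    deriv (theta1 τ) 0 * theta1 τ (a + u) * theta1 τ (a + v) * theta1 τ (u + v) =
      theta1 τ (u + v + a) * theta1 τ a *
        (deriv (theta1 τ) u * theta1 τ v + theta1 τ u * deriv (theta1 τ) v)
      - (deriv (theta1 τ) (u + v + a) * theta1 τ a - theta1 τ (u + v + a) * deriv (theta1 τ) a)
        * theta1 τ u * theta1 τ v := by
  have hd : ∀ c x : ℂ, HasDerivAt (fun s => theta1 τ (c + s)) (deriv (theta1 τ) (c + x)) x := by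
    intro c x
    exact HasDerivAt.comp_const_add c x (theta1_diff hτ (c + x)).hasDerivAt
  have hev : deriv (theta1 τ) (-v) = deriv (theta1 τ) v := by
    have h1 := hd 0 (-v)
    have h2 : HasDerivAt (fun s => theta1 τ s) (deriv (theta1 τ) v) (-v) := by
      have h3 : HasDerivAt (fun s => - theta1 τ (-s)) (-(deriv (theta1 τ) v * (-1))) (-v) := by
        refine HasDerivAt.neg ?_
        refine HasDerivAt.comp (h₂ := theta1 τ) (-v) ?_ (hasDerivAt_neg _)
        rw [neg_neg]
        exact (theta1_diff hτ v).hasDerivAt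
      simpa [theta1_neg] using h3
    exact h2.deriv
  have h1 := ((((hd (u + v + a) 0).mul_const (theta1 τ a)).mul_const (theta1 τ u)).mul (hd (-v) 0))
  have h2 := ((((hd (a + u) 0).mul_const (theta1 τ (a + v))).mul_const (theta1 τ (u + v))).mul (hd 0 0))
  have h3 := ((((hd a 0).const_mul (theta1 τ (u + v + a))).mul (hd u 0)).mul_const (theta1 τ v))
  have h4 := (h1.sub h2).add h3
  have h5 := h4.unique (f₁' := 0) (by
    convert hasDerivAt_const (0:ℂ) (0:ℂ) using 1
    funext s
    have := three_term hτ u v a s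
    simp only [Pi.add_apply, Pi.sub_apply, Pi.mul_apply]
    convert this using 4
    · congr 1; ring
    · congr 1; ring)
  simp only [add_zero, theta1_zero, theta1_neg, hev] at h5
  linear_combination -h5

end Theta

section NonVanish

theorem bounded_of_periods {τ : ℂ} (hτ : 0 < τ.im) {g : ℂ → ℂ} (hg : Continuous g)
    (h1 : ∀ p, g (p + 1 / 2) = g p) (h2 : ∀ p, g (p + τ / 2) = g p) :
    Bornology.IsBounded (Set.range g) := by
  have h1' : Function.Periodic g (1 / 2) := h1
  have h2' : Function.Periodic g (τ / 2) := h2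
  have hK : IsCompact (Set.Icc (-1 : ℝ) 1 ×ℂ Set.Icc (-τ.im) τ.im) :=
    isCompact_Icc.reProdIm isCompact_Icc
  refine (hK.image hg).isBounded.subset ?_
  rintro _ ⟨p, rfl⟩
  set n : ℤ := ⌊2 * p.im / τ.im⌋ with hn
  set q : ℂ := p - n * (τ / 2) with hq
  set m : ℤ := ⌊2 * q.re⌋ with hm
  refine ⟨q - m * (1 / 2), ?_, ?_⟩
  · have a1 := Int.floor_le (2 * q.re)
    have a2 := Int.lt_floor_add_one (2 * q.re)
    have b1 := Int.floor_le (2 * p.im / τ.im)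
    have b2 := Int.lt_floor_add_one (2 * p.im / τ.im)
    rw [le_div_iff₀ hτ] at b1
    rw [div_lt_iff₀ hτ] at b2
    rw [← hn] at b1 b2
    rw [← hm] at a1 a2
    have e1 : (q - m * (1 / 2)).re = q.re - m / 2 := by
      simp; ring
    have e2 : (q - m * (1 / 2)).im = p.im - n * τ.im / 2 := by
      simp [hq]
      ring
    rw [Complex.mem_reProdIm, e1, e2, Set.mem_Icc, Set.mem_Icc]
    refine ⟨⟨by linarith, by linarith⟩, by linarith, by linarith⟩
  · rw [h1'.sub_int_mul_eq m, hq, h2'.sub_int_mul_eq n]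

theorem tA_half (τ p : ℂ) : tA τ (p + 1 / 2) = tA τ p := by
  rw [tA, tA, show 2 * (p + 1 / 2) = 2 * p + 1 by ring, jacobiTheta₂_add_left]

theorem tB_half (τ p : ℂ) : tB τ (p + 1 / 2) = - tB τ p := by
  rw [tB, tB, show 2 * (p + 1 / 2) + τ = 2 * p + τ + 1 by ring, jacobiTheta₂_add_left,
    show Real.pi * Complex.I * τ / 2 + 2 * Real.pi * Complex.I * (p + 1 / 2) =
      Real.pi * Complex.I * τ / 2 + 2 * Real.pi * Complex.I * p + Real.pi * Complex.I by ring,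
    Complex.exp_add _ (Real.pi * Complex.I), Complex.exp_pi_mul_I]
  ring

theorem tA_tau (τ p : ℂ) : tA τ (p + τ / 2) =
    Complex.exp (-(Real.pi * Complex.I * τ / 2 + 2 * Real.pi * Complex.I * p)) * tB τ p := by
  rw [tA, tB, ← mul_assoc, ← Complex.exp_add, neg_add_cancel, Complex.exp_zero, one_mul]
  congr 1; ring

theorem tB_tau (τ p : ℂ) : tB τ (p + τ / 2) =
    Complex.exp (-(Real.pi * Complex.I * τ / 2 + 2 * Real.pi * Complex.I * p)) * tA τ p := by
  rw [tA, tB, show 2 * (p + τ / 2) + τ = 2 * p + 2 * τ by ring, jacobiTheta₂_add_left',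
    ← mul_assoc, ← Complex.exp_add]
  congr 2; ring

theorem theta1_zeros {τ : ℂ} (hτ : 0 < τ.im) (hne : ∃ w, theta1 τ w ≠ 0) {w₀ : ℂ}
    (h0 : theta1 τ w₀ = 0) : ∃ m n : ℤ, w₀ = m + n * τ := by
  have hV : ∀ p, tA τ p ≠ 0 ∨ tB τ p ≠ 0 := by
    intro p
    by_contra! hp
    have hprod : ∀ y, theta1 τ y * theta1 τ (2 * p - y) = 0 := by
      intro y
      have := bilin hτ p (y - p)
      rw [hp.1, hp.2, show p + (y - p) = y by ring, show p - (y - p) = 2 * p - y by ring] at this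
      simpa using this
    have hd := theta1_diff hτ
    have an1 : AnalyticOnNhd ℂ (theta1 τ) Set.univ :=
      hd.differentiableOn.analyticOnNhd isOpen_univ
    have hd2 : Differentiable ℂ (fun y => theta1 τ (2 * p - y)) := hd.comp (by fun_prop)
    have an2 : AnalyticOnNhd ℂ (fun y => theta1 τ (2 * p - y)) Set.univ :=
      hd2.differentiableOn.analyticOnNhd isOpen_univ
    obtain ⟨w, hw⟩ := hne
    rcases an1.eq_zero_or_eq_zero_of_mul_eq_zero an2 (by intro y _; exact hprod y)
      isPreconnected_univ with h | h
    · exact hw (h w (Set.mem_univ _))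
    · have := h (2 * p - w) (Set.mem_univ _)
      simp at this
      exact hw this
  have hprop : ∀ p, tA τ (p + w₀) * tB τ p = tB τ (p + w₀) * tA τ p := by
    intro p
    have := bilin hτ (p + w₀) p
    rw [show p + w₀ - p = w₀ by ring, h0, mul_zero] at this
    linear_combination -this
  classical
  obtain ⟨L, hL⟩ : ∃ L : ℂ → ℂ, ∀ p, tA τ (p + w₀) = L p * tA τ p ∧ tB τ (p + w₀) = L p * tB τ p := by
    refine ⟨fun p => if tA τ p ≠ 0 then tA τ (p + w₀) / tA τ p else tB τ (p + w₀) / tB τ p, ?_⟩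
    intro p
    have hpp := hprop p
    by_cases hA : tA τ p = 0
    · have hB : tB τ p ≠ 0 := (hV p).resolve_left (by simpa using hA)
      rw [hA, mul_zero] at hpp
      have := (mul_eq_zero.1 hpp).resolve_right hB
      simp [hA, this, hB]
    · simp only [ne_eq, hA, not_false_eq_true, if_true]
      constructor
      · field_simp
      · field_simp; linear_combination -hpp
  have huniq : ∀ p c, tA τ (p + w₀) = c * tA τ p → tB τ (p + w₀) = c * tB τ p → L p = c := by
    intro p c h1 h2
    rcases hV p with h | h
    · exact mul_right_cancel₀ h ((hL p).1.symm.trans h1)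
    · exact mul_right_cancel₀ h ((hL p).2.symm.trans h2)
  have hLne : ∀ p, L p ≠ 0 := by
    intro p hp
    have := hL p
    rw [hp, zero_mul, zero_mul] at this
    rcases hV (p + w₀) with h | h
    · exact h this.1
    · exact h this.2
  have hLd : Differentiable ℂ L := by
    intro p
    rcases hV p with h | h
    · have hev : ∀ᶠ q in nhds p, tA τ q ≠ 0 := (tA_diff hτ p).continuousAt.eventually_ne h
      have hd : DifferentiableAt ℂ (fun q => tA τ (q + w₀) / tA τ q) p :=
        DifferentiableAt.div ((tA_diff hτ).comp (g := tA τ) (f := fun q => q + w₀) (by fun_prop) p)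
          (tA_diff hτ p) h
      refine hd.congr_of_eventuallyEq ?_
      filter_upwards [hev] with q hq
      rw [(hL q).1]; field_simp
    · have hev : ∀ᶠ q in nhds p, tB τ q ≠ 0 := (tB_diff hτ p).continuousAt.eventually_ne h
      have hd : DifferentiableAt ℂ (fun q => tB τ (q + w₀) / tB τ q) p :=
        DifferentiableAt.div ((tB_diff hτ).comp (g := tB τ) (f := fun q => q + w₀) (by fun_prop) p)
          (tB_diff hτ p) h
      refine hd.congr_of_eventuallyEq ?_
      filter_upwards [hev] with q hq
      rw [(hL q).2]; field_simp
  have per1 : ∀ p, L (p + 1 / 2) = L p := by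
    intro p
    apply huniq
    · rw [show p + 1 / 2 + w₀ = p + w₀ + 1 / 2 by ring, tA_half, tA_half, (hL p).1]
    · rw [show p + 1 / 2 + w₀ = p + w₀ + 1 / 2 by ring, tB_half, tB_half, (hL p).2]; ring
  have per2 : ∀ p, L (p + τ / 2) = Complex.exp (-(2 * Real.pi * Complex.I * w₀)) * L p := by
    intro p
    have hE : Complex.exp (-(Real.pi * Complex.I * τ / 2 + 2 * Real.pi * Complex.I * (p + w₀))) =
        Complex.exp (-(2 * Real.pi * Complex.I * w₀)) *
          Complex.exp (-(Real.pi * Complex.I * τ / 2 + 2 * Real.pi * Complex.I * p)) := by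
      rw [← Complex.exp_add]; congr 1; ring
    apply huniq
    · rw [show p + τ / 2 + w₀ = p + w₀ + τ / 2 by ring, tA_tau, tA_tau, (hL p).2, hE]; ring
    · rw [show p + τ / 2 + w₀ = p + w₀ + τ / 2 by ring, tB_tau, tB_tau, (hL p).1, hE]; ring
  have hLd' : Differentiable ℂ (deriv L) := by
    have : AnalyticOnNhd ℂ L Set.univ := hLd.differentiableOn.analyticOnNhd isOpen_univ
    exact fun p => (this.deriv p (Set.mem_univ _)).differentiableAt
  have hgd : Differentiable ℂ (fun p => deriv L p / L p) := hLd'.div hLd hLne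
  have hb := bounded_of_periods hτ hgd.continuous (by
      intro p
      have : deriv L (p + 1 / 2) = deriv L p := by
        rw [← deriv_comp_add_const]; congr 1; funext q; exact per1 q
      rw [this, per1]) (by
      intro p
      have : deriv L (p + τ / 2) = Complex.exp (-(2 * Real.pi * Complex.I * w₀)) * deriv L p := by
        rw [← deriv_comp_add_const, ← deriv_const_mul _ (hLd p)]; congr 1; funext q; exact per2 q
      rw [this, per2, mul_div_mul_left _ _ (Complex.exp_ne_zero _)])
  set c := deriv L 0 / L 0 with hc
  have hconst : ∀ p, deriv L p = c * L p := by
    intro p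
    have := hgd.apply_eq_apply_of_bounded hb p 0
    simp only [← hc] at this
    rw [div_eq_iff (hLne p)] at this
    exact this
  have hexp : ∀ p, L p = L 0 * Complex.exp (c * p) := by
    intro p
    have hD : ∀ q, HasDerivAt (fun q => L q * Complex.exp (-(c * q))) 0 q := by
      intro q
      have e1 : HasDerivAt (fun q => Complex.exp (-(c * q))) (Complex.exp (-(c * q)) * (-(c * 1))) q :=
        (((hasDerivAt_id q).const_mul c).neg).cexp
      have := (hLd q).hasDerivAt.mul e1
      have e0 : deriv L q * Complex.exp (-(c * q)) + L q * (Complex.exp (-(c * q)) * -(c * 1)) = 0 := by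
        rw [hconst]; ring
      rw [e0] at this
      exact this
    have := is_const_of_deriv_eq_zero (fun q => (hD q).differentiableAt) (fun q => (hD q).deriv) p 0
    simp only [mul_zero, neg_zero, Complex.exp_zero, mul_one] at this
    rw [← this, mul_assoc, ← Complex.exp_add]
    simp
  have q1 := per1 0
  have q2 := per2 0
  rw [hexp (0 + 1 / 2), zero_add] at q1
  rw [hexp (0 + τ / 2), zero_add, mul_comm] at q2
  have q1' : Complex.exp (c * (1 / 2)) = 1 := by
    apply mul_left_cancel₀ (hLne 0); rw [q1, mul_one]
  have q2' := mul_right_cancel₀ (hLne 0) q2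
  rw [Complex.exp_eq_one_iff] at q1'
  obtain ⟨m, hm⟩ := q1'
  rw [Complex.exp_eq_exp_iff_exists_int] at q2'
  obtain ⟨k, hk⟩ := q2'
  refine ⟨k, -m, ?_⟩
  have hpi : (2 * Real.pi * Complex.I : ℂ) ≠ 0 := Complex.two_pi_I_ne_zero
  apply mul_left_cancel₀ hpi
  push_cast
  linear_combination hk - τ * hm

end NonVanish

section Final

theorem tau_im {ℓ : ℝ} (hℓ : 0 < ℓ) : 0 < (tau ℓ).im := by
  have : tau ℓ = ((2 * Real.pi / ℓ : ℝ) : ℂ) * Complex.I := by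
    unfold tau; push_cast; ring
  rw [this]
  simp
  positivity

theorem theta3_deriv {τ : ℂ} (hτ : 0 < τ.im) (w : ℂ) :
    deriv (theta3 τ) w = Complex.exp (Real.pi * Complex.I * τ / 4 + Real.pi * Complex.I * w) *
      (Real.pi * Complex.I * theta1 τ (w + (1 + τ) / 2) + deriv (theta1 τ) (w + (1 + τ) / 2)) := by
  have e1 : HasDerivAt (fun w => Complex.exp (Real.pi * Complex.I * τ / 4 + Real.pi * Complex.I * w))
      (Complex.exp (Real.pi * Complex.I * τ / 4 + Real.pi * Complex.I * w) *
        (Real.pi * Complex.I * 1)) w :=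
    (((hasDerivAt_id w).const_mul (Real.pi * Complex.I : ℂ)).const_add _).cexp
  have e2 : HasDerivAt (fun w => theta1 τ (w + (1 + τ) / 2)) (deriv (theta1 τ) (w + (1 + τ) / 2)) w :=
    HasDerivAt.comp_add_const w _ (theta1_diff hτ _).hasDerivAt
  have e3 := e1.mul e2
  have : theta3 τ = (fun w => Complex.exp (Real.pi * Complex.I * τ / 4 + Real.pi * Complex.I * w)) *
      (fun w => theta1 τ (w + (1 + τ) / 2)) := funext (theta3_shift τ)
  rw [this, e3.deriv]
  ring

theorem fay3 {τ : ℂ} (hτ : 0 < τ.im) (u v a : ℂ) :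
    deriv (theta1 τ) 0 * theta3 τ (u + a) * theta3 τ (v + a) * theta1 τ (u + v) =
      theta3 τ (u + v + a) * theta3 τ a *
        (deriv (theta1 τ) u * theta1 τ v + theta1 τ u * deriv (theta1 τ) v)
      - (deriv (theta3 τ) (u + v + a) * theta3 τ a - theta3 τ (u + v + a) * deriv (theta3 τ) a)
        * theta1 τ u * theta1 τ v := by
  have H := fay1 hτ u v (a + (1 + τ) / 2)
  have hE : Complex.exp (Real.pi * Complex.I * τ / 4 + Real.pi * Complex.I * (u + a)) *
      Complex.exp (Real.pi * Complex.I * τ / 4 + Real.pi * Complex.I * (v + a)) =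
      Complex.exp (Real.pi * Complex.I * τ / 4 + Real.pi * Complex.I * (u + v + a)) *
      Complex.exp (Real.pi * Complex.I * τ / 4 + Real.pi * Complex.I * a) := by
    rw [← Complex.exp_add, ← Complex.exp_add]; congr 1; ring
  rw [theta3_deriv hτ, theta3_deriv hτ, theta3_shift τ (u + a), theta3_shift τ (v + a),
    theta3_shift τ (u + v + a), theta3_shift τ a]
  rw [show u + a + (1 + τ) / 2 = a + (1 + τ) / 2 + u by ring,
    show v + a + (1 + τ) / 2 = a + (1 + τ) / 2 + v by ring,
    show u + v + a + (1 + τ) / 2 = u + v + (a + (1 + τ) / 2) by ring]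
  generalize Complex.exp (Real.pi * Complex.I * τ / 4 + Real.pi * Complex.I * (u + a)) = E1 at *
  generalize Complex.exp (Real.pi * Complex.I * τ / 4 + Real.pi * Complex.I * (v + a)) = E2 at *
  generalize Complex.exp (Real.pi * Complex.I * τ / 4 + Real.pi * Complex.I * (u + v + a)) = E3 at *
  generalize Complex.exp (Real.pi * Complex.I * τ / 4 + Real.pi * Complex.I * a) = E4 at *
  linear_combination E3 * E4 * H + deriv (theta1 τ) 0 * theta1 τ (a + (1 + τ) / 2 + u) *
    theta1 τ (a + (1 + τ) / 2 + v) * theta1 τ (u + v) * hE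

/-- The `μ`-derivative of `fmu`. -/
noncomputable def dfmu (ℓ μ : ℝ) (z : ℂ) : ℂ :=
  (ℓ : ℂ)⁻¹ * (2 / (Real.pi * Complex.I) * deriv (theta1 (tau ℓ)) 0 *
    (deriv (theta3 (tau ℓ)) (z / ℓ + μ) * theta3 (tau ℓ) μ
      - theta3 (tau ℓ) (z / ℓ + μ) * deriv (theta3 (tau ℓ)) μ) /
    (theta3 (tau ℓ) μ ^ 2 * theta1 (tau ℓ) (z / ℓ)))

theorem hasDerivAt_fmu {ℓ : ℝ} (hℓ : 0 < ℓ) {μ : ℝ} (hμ : theta3 (tau ℓ) μ ≠ 0) {z : ℂ}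
    (hz : theta1 (tau ℓ) (z / ℓ) ≠ 0) :
    HasDerivAt (fun s : ℝ => fmu ℓ s z) (dfmu ℓ μ z) μ := by
  have hτ := tau_im hℓ
  have h1 : HasDerivAt (fun s : ℂ => theta3 (tau ℓ) (z / ℓ + s))
      (deriv (theta3 (tau ℓ)) (z / ℓ + μ)) (μ : ℂ) :=
    HasDerivAt.comp_const_add _ _ (theta3_diff hτ _).hasDerivAt
  have h2 : HasDerivAt (theta3 (tau ℓ)) (deriv (theta3 (tau ℓ)) μ) (μ : ℂ) :=
    (theta3_diff hτ _).hasDerivAt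
  have h3 := (((h1.const_mul (2 / (Real.pi * Complex.I) * deriv (theta1 (tau ℓ)) 0)).div
    (h2.mul_const (theta1 (tau ℓ) (z / ℓ))) (mul_ne_zero hμ hz)).const_mul (ℓ : ℂ)⁻¹).comp_ofReal
  have h4 : HasDerivAt (fun s : ℝ => fmu ℓ s z) _ μ := h3
  refine h4.congr_deriv ?_
  unfold dfmu
  field_simp

theorem fmu_mul {ℓ : ℝ} (hℓ : 0 < ℓ) {μ : ℝ} (hμ : theta3 (tau ℓ) μ ≠ 0) {x y : ℂ}
    (hx : theta1 (tau ℓ) (x / ℓ) ≠ 0) (hy : theta1 (tau ℓ) (y / ℓ) ≠ 0)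
    (hxy : theta1 (tau ℓ) ((x + y) / ℓ) ≠ 0) :
    (Real.pi : ℂ) * ℓ / (2 * Complex.I) * (fmu ℓ μ x * fmu ℓ μ y) =
      dfmu ℓ μ (x + y) - fmu ℓ μ (x + y) *
        (deriv (theta1 (tau ℓ)) (x / ℓ) / theta1 (tau ℓ) (x / ℓ) +
          deriv (theta1 (tau ℓ)) (y / ℓ) / theta1 (tau ℓ) (y / ℓ)) := by
  have H := fay3 (tau_im hℓ) (x / ℓ) (y / ℓ) μ
  rw [← add_div] at H
  unfold dfmu fmu gmu
  have hl : (ℓ : ℂ) ≠ 0 := by exact_mod_cast hℓ.ne'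
  have hpi : (Real.pi : ℂ) ≠ 0 := by exact_mod_cast Real.pi_ne_zero
  generalize deriv (theta1 (tau ℓ)) 0 = k0 at *
  generalize theta1 (tau ℓ) ((x + y) / ℓ) = hs at *
  generalize deriv (theta1 (tau ℓ)) (x / ℓ) = dx at *
  generalize deriv (theta1 (tau ℓ)) (y / ℓ) = dy at *
  generalize theta1 (tau ℓ) (x / ℓ) = h1 at *
  generalize theta1 (tau ℓ) (y / ℓ) = h2 at *
  generalize theta3 (tau ℓ) (x / ℓ + μ) = t1 at *
  generalize theta3 (tau ℓ) (y / ℓ + μ) = t2 at *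
  generalize deriv (theta3 (tau ℓ)) ((x + y) / ℓ + μ) = d3 at *
  generalize theta3 (tau ℓ) ((x + y) / ℓ + μ) = t3 at *
  generalize deriv (theta3 (tau ℓ)) μ = d0 at *
  generalize theta3 (tau ℓ) μ = t0 at *
  have hI : Complex.I ≠ 0 := Complex.I_ne_zero
  have hI2 : Complex.I ^ 2 = -1 := Complex.I_sq
  field_simp
  rw [hI2]
  linear_combination k0 * H

theorem dtheta1_neg {τ : ℂ} (hτ : 0 < τ.im) (v : ℂ) :
    deriv (theta1 τ) (-v) = deriv (theta1 τ) v := by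
  have h3 : HasDerivAt (fun s => - theta1 τ (-s)) (-(deriv (theta1 τ) v * (-1))) (-v) := by
    refine HasDerivAt.neg ?_
    refine HasDerivAt.comp (h₂ := theta1 τ) (-v) ?_ (hasDerivAt_neg _)
    rw [neg_neg]
    exact (theta1_diff hτ v).hasDerivAt
  have h2 : HasDerivAt (fun s => theta1 τ s) (deriv (theta1 τ) v) (-v) := by
    simpa [theta1_neg] using h3
  exact h2.deriv

theorem theta1_ne_zero_of_lat {ℓ : ℝ} (hℓ : 0 < ℓ) {μ : ℝ} (hμ : theta3 (tau ℓ) μ ≠ 0) {z : ℂ}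
    (hz : z ∉ lat (ℓ : ℂ) (2 * Real.pi * Complex.I)) : theta1 (tau ℓ) (z / ℓ) ≠ 0 := by
  intro h
  have hl : (ℓ : ℂ) ≠ 0 := by exact_mod_cast hℓ.ne'
  obtain ⟨m, n, hmn⟩ := theta1_zeros (tau_im hℓ) ⟨μ + (1 + tau ℓ) / 2, fun h0 => hμ (by
    rw [theta3_shift, h0, mul_zero])⟩ h
  refine hz ⟨m, n, ?_⟩
  rw [div_eq_iff hl] at hmn
  rw [hmn, tau]
  field_simp

end Final

/-- Proposition, eq. 3.10: the `μ`-derivative of the `n`-cycle sum equals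
`(πℓ/(2i))` times the `(n+1)`-cycle sum. -/
theorem stmt7 (ℓ : ℝ) (hℓ : 0 < ℓ) (n : ℕ) (hn : 2 ≤ n)
    (z : Fin (n + 1) → ℂ)
    (hz : ∀ j k : Fin (n + 1), j ≠ k →
      z j - z k ∉ lat (ℓ : ℂ) (2 * Real.pi * Complex.I)) :
    ∀ μ : ℝ, theta3 (tau ℓ) (μ : ℂ) ≠ 0 →
      HasDerivAt (fun s : ℝ => cycleSum n (fmu ℓ s) (fun k => z k.castSucc))
        ((Real.pi : ℂ) * (ℓ : ℂ) / (2 * Complex.I) * cycleSum (n + 1) (fmu ℓ μ) z) μ := by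
  intro μ hμ
  have hnt : Nontrivial (Fin n) := Fin.nontrivial_iff_two_le.2 hn
  have hτ := tau_im hℓ
  have hnz : ∀ j k : Fin (n + 1), j ≠ k → theta1 (tau ℓ) ((z j - z k) / ℓ) ≠ 0 :=
    fun j k hjk => theta1_ne_zero_of_lat hℓ hμ (hz j k hjk)
  rw [cycleSum_succ n hn]
  simp only [cycleSum_eq n hn]
  have hσ : ∀ σ ∈ fullSet n, ∀ k, σ k ≠ k := by
    classical
    intro σ h k
    have h' : IsFull σ := by simpa [fullSet] using h
    have := ((isFull_iff σ).2 h').2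
    rw [← Equiv.Perm.mem_support, this]
    exact Finset.mem_univ _
  have hD : HasDerivAt (fun s : ℝ => ∑ σ ∈ fullSet n, ∏ k, fmu ℓ s (z (σ k).castSucc - z k.castSucc))
      (∑ σ ∈ fullSet n, ∑ k, (∏ j ∈ Finset.univ.erase k,
        fmu ℓ μ (z (σ j).castSucc - z j.castSucc)) • dfmu ℓ μ (z (σ k).castSucc - z k.castSucc)) μ := by
    refine HasDerivAt.fun_sum fun σ hs => ?_
    refine HasDerivAt.fun_finsetProd fun k _ => ?_
    refine hasDerivAt_fmu hℓ hμ (hnz _ _ ?_)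
    simpa using hσ σ hs k
  convert hD using 1
  rw [Finset.mul_sum]
  refine Finset.sum_congr rfl fun σ hs => ?_
  set x := z (Fin.last n) with hx
  set G : Fin n → ℂ := fun k => deriv (theta1 (tau ℓ)) ((z k.castSucc - x) / ℓ) /
    theta1 (tau ℓ) ((z k.castSucc - x) / ℓ) with hG
  have key : ∀ k, (Real.pi : ℂ) * ℓ / (2 * Complex.I) *
      (fmu ℓ μ (z (σ k).castSucc - x) * fmu ℓ μ (x - z k.castSucc)) =
      dfmu ℓ μ (z (σ k).castSucc - z k.castSucc) -
        fmu ℓ μ (z (σ k).castSucc - z k.castSucc) * (G (σ k) - G k) := by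
    intro k
    have h1 := hnz (σ k).castSucc (Fin.last n) (Fin.castSucc_lt_last _).ne
    have h2 := hnz (Fin.last n) k.castSucc (Fin.castSucc_lt_last _).ne'
    have h3 := hnz (σ k).castSucc k.castSucc (by simpa using hσ σ hs k)
    have := fmu_mul hℓ hμ h1 h2 (by rwa [sub_add_sub_cancel])
    rw [sub_add_sub_cancel] at this
    rw [this]
    congr 2
    have e : (z (Fin.last n) - z k.castSucc) / ℓ = -((z k.castSucc - x) / ℓ) := by
      rw [hx]; ring
    rw [e, theta1_neg, dtheta1_neg hτ, div_neg, ← sub_eq_add_neg]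
  have hsum : ∑ k, (G (σ k) - G k) = 0 := by
    rw [Finset.sum_sub_distrib, Equiv.sum_comp σ G, sub_self]
  rw [Finset.mul_sum, ← sub_eq_zero, ← Finset.sum_sub_distrib]
  have hterm : ∀ k, (Real.pi : ℂ) * ℓ / (2 * Complex.I) *
      ((∏ j ∈ Finset.univ.erase k, fmu ℓ μ (z (σ j).castSucc - z j.castSucc)) *
        (fmu ℓ μ (z (σ k).castSucc - x) * fmu ℓ μ (x - z k.castSucc))) -
      (∏ j ∈ Finset.univ.erase k, fmu ℓ μ (z (σ j).castSucc - z j.castSucc)) •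
        dfmu ℓ μ (z (σ k).castSucc - z k.castSucc) =
      -(∏ j, fmu ℓ μ (z (σ j).castSucc - z j.castSucc)) * (G (σ k) - G k) := by
    intro k
    rw [← Finset.mul_prod_erase Finset.univ _ (Finset.mem_univ k), smul_eq_mul]
    linear_combination (∏ j ∈ Finset.univ.erase k, fmu ℓ μ (z (σ j).castSucc - z j.castSucc)) * key k
  rw [Finset.sum_congr rfl fun k _ => hterm k, ← Finset.mul_sum, hsum, mul_zero]
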